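/- Let n be a natural number and S : Fin n → Finset (Fin n) a family of n subsets of {1, …, n}. Let A be the ℕ-valued incidence matrix with A i j = 1 if j ∈ S i and 0 otherwise, and define det⁺A = ∑_{σ even} ∏_i A i (σ i) and det⁻A = ∑_{σ odd} ∏_i A i (σ i) in ℕ. Then the family S has the disparate union property — for all disjoint finite index sets I₁, I₂ ⊆ Fin n, not both empty, ⋃_{a ∈ I₁} S a ≠ ⋃_{b ∈ I₂} S b — if and only if exactly one of det⁺A, det⁻A is zero. -/

import Mathlib

/-- The positive determinant: sum of diagonal products over even permutations. -/
def detPlus {M : Type*} [CommSemiring M] {n : ℕ} (A : Matrix (Fin n) (Fin n) M) : M :=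
  ∑ σ ∈ Finset.univ.filter (fun σ : Equiv.Perm (Fin n) => Equiv.Perm.sign σ = 1),
    ∏ i, A i (σ i)

/-- The negative determinant: sum of diagonal products over odd permutations. -/
def detMinus {M : Type*} [CommSemiring M] {n : ℕ} (A : Matrix (Fin n) (Fin n) M) : M :=
  ∑ σ ∈ Finset.univ.filter (fun σ : Equiv.Perm (Fin n) => Equiv.Perm.sign σ = -1),
    ∏ i, A i (σ i)

open Finset Matrix

/-- The entries of `B` are positive at the positions `(i, j)` with `j ∈ S i`, and zero elsewhere. -/
def HasSupport {M : Type*} [Zero M] [LT M] {n : ℕ} (S : Fin n → Finset (Fin n))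
    (B : Matrix (Fin n) (Fin n) M) : Prop :=
  ∀ i j, (j ∈ S i → 0 < B i j) ∧ (j ∉ S i → B i j = 0)

namespace HasSupport

section Ordered

variable {M : Type*} {n : ℕ} {S : Fin n → Finset (Fin n)} {B : Matrix (Fin n) (Fin n) M}

theorem nonneg [Zero M] [Preorder M] (hB : HasSupport S B) (i j : Fin n) : 0 ≤ B i j := by
  by_cases h : j ∈ S i
  · exact ((hB i j).1 h).le
  · exact ((hB i j).2 h).ge

variable [CommSemiring M] [PartialOrder M] [IsStrictOrderedRing M] [NoZeroDivisors M]

theorem prod_ne_zero_iff (hB : HasSupport S B) (σ : Equiv.Perm (Fin n)) :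
    ∏ i, B i (σ i) ≠ 0 ↔ ∀ i, σ i ∈ S i := by
  rw [Finset.prod_ne_zero_iff]
  refine ⟨fun h i => ?_, fun h i _ => ((hB i _).1 (h i)).ne'⟩
  by_contra hi
  exact h i (mem_univ i) ((hB i _).2 hi)

theorem sum_prod_ne_zero_iff (hB : HasSupport S B) (P : Finset (Equiv.Perm (Fin n))) :
    ∑ σ ∈ P, ∏ i, B i (σ i) ≠ 0 ↔ ∃ σ ∈ P, ∀ i, σ i ∈ S i := by
  rw [Ne, sum_eq_zero_iff_of_nonneg fun σ _ => prod_nonneg fun i _ => hB.nonneg i (σ i)]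
  simp only [← hB.prod_ne_zero_iff]
  push Not
  rfl

theorem detPlus_ne_zero_iff (hB : HasSupport S B) :
    detPlus B ≠ 0 ↔ ∃ σ : Equiv.Perm (Fin n), Equiv.Perm.sign σ = 1 ∧ ∀ i, σ i ∈ S i := by
  simpa [detPlus] using hB.sum_prod_ne_zero_iff (univ.filter fun σ => Equiv.Perm.sign σ = 1)

theorem detMinus_ne_zero_iff (hB : HasSupport S B) :
    detMinus B ≠ 0 ↔ ∃ σ : Equiv.Perm (Fin n), Equiv.Perm.sign σ = -1 ∧ ∀ i, σ i ∈ S i := by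
  simpa [detMinus] using hB.sum_prod_ne_zero_iff (univ.filter fun σ => Equiv.Perm.sign σ = -1)

end Ordered

end HasSupport

theorem det_eq_detPlus_sub_detMinus {R : Type*} [CommRing R] {n : ℕ}
    (B : Matrix (Fin n) (Fin n) R) : B.det = detPlus B - detMinus B := by
  have hfilter : (univ.filter fun σ : Equiv.Perm (Fin n) => ¬Equiv.Perm.sign σ = 1) =
      univ.filter fun σ => Equiv.Perm.sign σ = -1 := by
    ext σ
    rcases Int.units_eq_one_or (Equiv.Perm.sign σ) with h | h <;> simp [h]
  rw [← det_transpose, det_apply', ← sum_filter_add_sum_filter_not univ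
    (fun σ : Equiv.Perm (Fin n) => Equiv.Perm.sign σ = 1), hfilter, detPlus, detMinus,
    sub_eq_add_neg, ← sum_neg_distrib]
  congr 1 <;> refine sum_congr rfl fun σ hσ => ?_ <;> simp [(mem_filter.1 hσ).2]

section Real

variable {n : ℕ} {S : Fin n → Finset (Fin n)}

theorem HasSupport.exists_sign_mul_det_pos (σ : Equiv.Perm (Fin n)) (hσ : ∀ i, σ i ∈ S i) :
    ∃ B : Matrix (Fin n) (Fin n) ℝ, HasSupport S B ∧
      0 < ((Equiv.Perm.sign σ : ℤ) : ℝ) * B.det := by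
  let B : ℝ → Matrix (Fin n) (Fin n) ℝ := fun ε => Matrix.of fun i j =>
    if σ i = j then 1 else if j ∈ S i then ε else 0
  have hcont : Continuous fun ε => ((Equiv.Perm.sign σ : ℤ) : ℝ) * (B ε).det := by
    refine continuous_const.mul (Continuous.matrix_det ?_)
    refine continuous_pi fun i => continuous_pi fun j => ?_
    simp only [B, of_apply]
    split_ifs <;> fun_prop
  have hzero : 0 < ((Equiv.Perm.sign σ : ℤ) : ℝ) * (B 0).det := by
    have hperm : B 0 = σ.toPEquiv.toMatrix := by
      ext i j
      simp [B, PEquiv.toMatrix_apply, Equiv.toPEquiv_apply]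
    rw [hperm, det_permutation]
    rcases Int.units_eq_one_or (Equiv.Perm.sign σ) with h | h <;> simp [h]
  have hev : ∀ᶠ ε in nhdsWithin (0 : ℝ) (Set.Ioi 0),
      0 < ((Equiv.Perm.sign σ : ℤ) : ℝ) * (B ε).det :=
    (hcont.continuousAt.eventually (lt_mem_nhds hzero)).filter_mono nhdsWithin_le_nhds
  obtain ⟨ε, hdet, hε⟩ := (hev.and self_mem_nhdsWithin).exists
  refine ⟨B ε, fun i j => ⟨fun hj => ?_, fun hj => ?_⟩, hdet⟩
  · by_cases h : σ i = j
    · simp [B, h]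
    · simpa [B, h, hj] using hε
  · have h : σ i ≠ j := fun h => hj (h ▸ hσ i)
    simp [B, h, hj]

theorem convex_setOf_hasSupport (S : Fin n → Finset (Fin n)) :
    Convex ℝ {B : Matrix (Fin n) (Fin n) ℝ | HasSupport S B} := by
  intro B hB C hC a b ha hb hab i j
  refine ⟨fun hj => ?_, fun hj => ?_⟩
  · exact convex_Ioi (0 : ℝ) ((hB i j).1 hj) ((hC i j).1 hj) ha hb hab
  · simp [(hB i j).2 hj, (hC i j).2 hj]

/-- A singular real matrix with support `S` exists exactly when `S` lacks the disparate union
property. -/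
theorem exists_hasSupport_det_eq_zero_iff (S : Fin n → Finset (Fin n)) :
    (∃ B : Matrix (Fin n) (Fin n) ℝ, HasSupport S B ∧ B.det = 0) ↔
      ∃ I₁ I₂ : Finset (Fin n), Disjoint I₁ I₂ ∧ ¬(I₁ = ∅ ∧ I₂ = ∅) ∧ I₁.sup S = I₂.sup S := by
  constructor
  · rintro ⟨B, hB, hdet⟩
    obtain ⟨v, hv, hvB⟩ := exists_vecMul_eq_zero_iff.2 hdet
    have subset_of_vecMul_eq_zero : ∀ w : Fin n → ℝ, w ᵥ* B = 0 →
        (univ.filter fun i => 0 < w i).sup S ⊆ (univ.filter fun i => w i < 0).sup S := by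
      intro w hw j hj
      simp only [mem_sup, mem_filter, mem_univ, true_and] at hj ⊢
      obtain ⟨a, ha, haj⟩ := hj
      by_contra! hneg
      refine (sum_pos' (fun i _ => ?_) ⟨a, mem_univ a, mul_pos ha ((hB a j).1 haj)⟩).ne'
        (congrFun hw j)
      by_cases hi : w i < 0
      · simp [(hB i j).2 (hneg i hi)]
      · exact mul_nonneg (not_lt.1 hi) (hB.nonneg i j)
    refine ⟨univ.filter fun i => 0 < v i, univ.filter fun i => v i < 0, ?_, ?_, ?_⟩
    · exact disjoint_filter.2 fun i _ h => h.not_gt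
    · rintro ⟨h₁, h₂⟩
      rw [filter_eq_empty_iff] at h₁ h₂
      exact hv (funext fun i =>
        le_antisymm (not_lt.1 (h₁ (mem_univ i))) (not_lt.1 (h₂ (mem_univ i))))
    · refine (subset_of_vecMul_eq_zero v hvB).antisymm ?_
      simpa using subset_of_vecMul_eq_zero (-v) (by rw [neg_vecMul, hvB, neg_zero])
  · rintro ⟨I₁, I₂, hdisj, hne, hsup⟩
    let c : Finset (Fin n) → Fin n → ℝ := fun I j => #{i ∈ I | j ∈ S i}
    have c_pos : ∀ (I : Finset (Fin n)) (j : Fin n), j ∈ I.sup S → 0 < c I j := by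
      intro I j hj
      obtain ⟨i, hi, hij⟩ := mem_sup.1 hj
      exact Nat.cast_pos.2 (card_pos.2 ⟨i, mem_filter.2 ⟨hi, hij⟩⟩)
    let B : Matrix (Fin n) (Fin n) ℝ := Matrix.of fun i j =>
      if j ∈ S i then if i ∈ I₁ then c I₂ j else if i ∈ I₂ then c I₁ j else 1 else 0
    let v : Fin n → ℝ := fun i => (if i ∈ I₁ then 1 else 0) - (if i ∈ I₂ then 1 else 0)
    refine ⟨B, fun i j => ⟨fun hj => ?_, fun hj => by simp [B, hj]⟩,
      exists_vecMul_eq_zero_iff.1 ⟨v, ?_, ?_⟩⟩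
    · simp only [B, of_apply, if_pos hj]
      split_ifs with h₁ h₂
      · exact c_pos _ _ (hsup ▸ mem_sup.2 ⟨i, h₁, hj⟩)
      · exact c_pos _ _ (hsup ▸ mem_sup.2 ⟨i, h₂, hj⟩)
      · exact one_pos
    · intro hv
      refine hne ⟨eq_empty_of_forall_notMem fun i hi => ?_,
        eq_empty_of_forall_notMem fun i hi => ?_⟩
      · simpa [v, hi, disjoint_left.1 hdisj hi] using congrFun hv i
      · simpa [v, hi, disjoint_right.1 hdisj hi] using congrFun hv i
    · ext j
      have hterm : ∀ i, v i * B i j =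
          (if i ∈ I₁ then if j ∈ S i then c I₂ j else 0 else 0) -
            (if i ∈ I₂ then if j ∈ S i then c I₁ j else 0 else 0) := by
        intro i
        by_cases h₁ : i ∈ I₁
        · simp [v, B, h₁, disjoint_left.1 hdisj h₁]
        · by_cases h₂ : i ∈ I₂ <;> by_cases hj : j ∈ S i <;> simp [v, B, h₁, h₂, hj]
      have hsum : ∀ (I : Finset (Fin n)) (r : ℝ),
          ∑ i, (if i ∈ I then if j ∈ S i then r else 0 else 0) = c I j * r := by
        intro I r
        rw [sum_ite_mem, univ_inter, ← sum_filter, sum_const, nsmul_eq_mul]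
      change ∑ i, v i * B i j = 0
      simp only [hterm, sum_sub_distrib, hsum]
      ring

/-- Every real matrix with support `S` is nonsingular exactly when the transversals of `S` exist
and all have the same sign. -/
theorem exists_hasSupport_det_eq_zero_iff_detPlus_detMinus {A : Matrix (Fin n) (Fin n) ℕ}
    (hA : HasSupport S A) :
    (∃ B : Matrix (Fin n) (Fin n) ℝ, HasSupport S B ∧ B.det = 0) ↔
      (detPlus A = 0 ↔ detMinus A = 0) := by
  have transfer : ∀ {B : Matrix (Fin n) (Fin n) ℝ}, HasSupport S B →
      (detPlus A = 0 ↔ detPlus B = 0) ∧ (detMinus A = 0 ↔ detMinus B = 0) := fun hB =>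
    ⟨not_iff_not.1 (hA.detPlus_ne_zero_iff.trans hB.detPlus_ne_zero_iff.symm),
      not_iff_not.1 (hA.detMinus_ne_zero_iff.trans hB.detMinus_ne_zero_iff.symm)⟩
  constructor
  · rintro ⟨B, hB, hdet⟩
    rw [det_eq_detPlus_sub_detMinus, sub_eq_zero] at hdet
    rw [(transfer hB).1, (transfer hB).2, hdet]
  · intro h
    by_cases h₁ : detPlus A = 0
    · have hB : HasSupport S (A.map (Nat.cast : ℕ → ℝ)) := fun i j =>
        ⟨fun hj => Nat.cast_pos.2 ((hA i j).1 hj), fun hj => by simp [(hA i j).2 hj]⟩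
      refine ⟨_, hB, ?_⟩
      rw [det_eq_detPlus_sub_detMinus, (transfer hB).1.1 h₁, (transfer hB).2.1 (h.1 h₁), sub_zero]
    · obtain ⟨σ, hσ, hσS⟩ := hA.detPlus_ne_zero_iff.1 h₁
      obtain ⟨τ, hτ, hτS⟩ := hA.detMinus_ne_zero_iff.1 (mt h.2 h₁)
      obtain ⟨B, hB, hBpos⟩ := HasSupport.exists_sign_mul_det_pos σ hσS
      obtain ⟨C, hC, hCneg⟩ := HasSupport.exists_sign_mul_det_pos τ hτS
      simp only [hσ, hτ, Units.val_one, Units.val_neg, Int.cast_one, Int.cast_neg, one_mul,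
        neg_mul, neg_pos] at hBpos hCneg
      exact (convex_setOf_hasSupport S).isPreconnected.intermediate_value hC hB
        (Continuous.matrix_det continuous_id).continuousOn ⟨hCneg.le, hBpos.le⟩

end Real

/-- A family of `n` subsets of `{1, …, n}` has the disparate
union property iff exactly one of `det⁺A`, `det⁻A` of its ℕ-incidence matrix is
zero. -/
theorem stmt_11 {n : ℕ} (S : Fin n → Finset (Fin n))
    (A : Matrix (Fin n) (Fin n) ℕ)
    (hA : ∀ i j, A i j = if j ∈ S i then 1 else 0) :
    (∀ I₁ I₂ : Finset (Fin n), Disjoint I₁ I₂ → ¬(I₁ = ∅ ∧ I₂ = ∅) →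
        I₁.sup S ≠ I₂.sup S) ↔
      ((detPlus A = 0 ∧ detMinus A ≠ 0) ∨ (detPlus A ≠ 0 ∧ detMinus A = 0)) := by
  have hsupp : HasSupport S A := fun i j => by by_cases h : j ∈ S i <;> simp [hA, h]
  have key := (exists_hasSupport_det_eq_zero_iff S).symm.trans
    (exists_hasSupport_det_eq_zero_iff_detPlus_detMinus hsupp)
  have hnot : (∀ I₁ I₂ : Finset (Fin n), Disjoint I₁ I₂ → ¬(I₁ = ∅ ∧ I₂ = ∅) →
      I₁.sup S ≠ I₂.sup S) ↔ ¬∃ I₁ I₂ : Finset (Fin n),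
        Disjoint I₁ I₂ ∧ ¬(I₁ = ∅ ∧ I₂ = ∅) ∧ I₁.sup S = I₂.sup S := by
    simp only [not_exists, not_and, ne_eq]
  rw [hnot, key]
  tauto
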